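/- In G = ℤ ≀ ℤ (notation below), for all integers m and n: m divides n if and only if the product set H·C_G(b·aᵐ) contains the product set H·C_G(b·aⁿ). -/

import Mathlib

open Pointwise

/-- The shift `e_k ↦ e_{k+n}` on the free abelian group `⨁_{k∈ℤ} ℤ` (= `ℤ →₀ ℤ`). -/
noncomputable def shiftAut (n : ℤ) : (ℤ →₀ ℤ) ≃+ (ℤ →₀ ℤ) :=
  Finsupp.domCongr (Equiv.addRight n)

/-- The action of `ℤ` on `⨁_{k∈ℤ} ℤ` by shifting the coordinates. -/
noncomputable def shiftHom :
    Multiplicative ℤ →* MulAut (Multiplicative (ℤ →₀ ℤ)) :=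
  MonoidHom.mk' (fun n => AddEquiv.toMultiplicative (shiftAut n.toAdd))
    (by
      intro m n
      refine MulEquiv.ext fun x => ?_
      show Multiplicative.ofAdd (shiftAut (m.toAdd + n.toAdd) x.toAdd) =
        Multiplicative.ofAdd (shiftAut m.toAdd (shiftAut n.toAdd x.toAdd))
      congr 1
      ext k
      simp [shiftAut, Finsupp.domCongr_apply, Finsupp.equivMapDomain_apply, sub_sub,
        add_comm, Equiv.Perm.mul_def, Equiv.symm_trans_apply]
      congr 1
      ring)

/-- The restricted wreath product `ℤ ≀ ℤ = (⨁_{k∈ℤ} ℤ) ⋊ ℤ`, with `ℤ` acting by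
shifting the coordinates. -/
abbrev ZwrZ : Type :=
  SemidirectProduct (Multiplicative (ℤ →₀ ℤ)) (Multiplicative ℤ) shiftHom

/-- The element `a = (0, 1)` of `ℤ ≀ ℤ`. -/
noncomputable def wa : ZwrZ := SemidirectProduct.inr (Multiplicative.ofAdd (1 : ℤ))

/-- The element `b = (e₀, 0)` of `ℤ ≀ ℤ`. -/
noncomputable def wb : ZwrZ :=
  SemidirectProduct.inl (Multiplicative.ofAdd (Finsupp.single (0 : ℤ) (1 : ℤ)))

/-- The base subgroup `H × {0}` of `ℤ ≀ ℤ`, where `H = ⨁_{k∈ℤ} ℤ`. -/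
noncomputable def baseH : Subgroup ZwrZ :=
  (SemidirectProduct.inl : Multiplicative (ℤ →₀ ℤ) →* ZwrZ).range

/-- The shift by `n` becomes trivial after reducing the indices modulo `n`. -/
theorem mapDomain_intCast_shiftAut (n : ℤ) (h : ℤ →₀ ℤ) :
    (shiftAut n h).mapDomain (Int.cast : ℤ → ZMod n.natAbs) =
      h.mapDomain (Int.cast : ℤ → ZMod n.natAbs) := by
  have hn : ((n : ℤ) : ZMod n.natAbs) = 0 :=
    (ZMod.intCast_zmod_eq_zero_iff_dvd n n.natAbs).2 (Int.natAbs_dvd.2 dvd_rfl)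
  rw [shiftAut, Finsupp.domCongr_apply, Finsupp.equivMapDomain_eq_mapDomain,
    ← Finsupp.mapDomain_comp]
  congr 1
  ext k
  simp [hn]

theorem rightHom_wb_mul_wa_zpow (n : ℤ) :
    SemidirectProduct.rightHom (wb * wa ^ n) = Multiplicative.ofAdd n := by
  rw [map_mul, map_zpow, wa, wb, SemidirectProduct.rightHom_inl, SemidirectProduct.rightHom_inr,
    one_mul, ← ofAdd_zsmul, smul_eq_mul, mul_one]

theorem left_wb_mul_wa_zpow (n : ℤ) :
    (wb * wa ^ n).left = Multiplicative.ofAdd (Finsupp.single (0 : ℤ) (1 : ℤ)) := by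
  rw [wa, ← map_zpow, wb, SemidirectProduct.mul_left, SemidirectProduct.left_inl,
    SemidirectProduct.left_inr, map_one, mul_one]

theorem dvd_right_of_mem_centralizer {n : ℤ} {c : ZwrZ}
    (hc : c ∈ Subgroup.centralizer {wb * wa ^ n}) : n ∣ c.right.toAdd := by
  have hleft := congrArg SemidirectProduct.left (Subgroup.mem_centralizer_singleton_iff.1 hc)
  have hright : (wb * wa ^ n).right = Multiplicative.ofAdd n := rightHom_wb_mul_wa_zpow n
  rw [SemidirectProduct.mul_left c, SemidirectProduct.mul_left _ c, left_wb_mul_wa_zpow, hright]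
    at hleft
  have hadd : c.left.toAdd + shiftAut c.right.toAdd (Finsupp.single 0 1) =
      Finsupp.single 0 1 + shiftAut n c.left.toAdd := hleft
  have hmod := congrArg (Finsupp.mapDomain (Int.cast : ℤ → ZMod n.natAbs)) hadd
  rw [Finsupp.mapDomain_add, Finsupp.mapDomain_add, mapDomain_intCast_shiftAut, add_comm,
    add_left_inj] at hmod
  have hk : ((c.right.toAdd : ℤ) : ZMod n.natAbs) = 0 := by
    simpa [shiftAut, Finsupp.domCongr_apply, Finsupp.mapDomain_single,
      Finsupp.single_left_inj] using hmod
  exact Int.natAbs_dvd.1 ((ZMod.intCast_zmod_eq_zero_iff_dvd _ _).1 hk)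

theorem mem_baseH_iff {g : ZwrZ} : g ∈ baseH ↔ SemidirectProduct.rightHom g = 1 := by
  rw [baseH, SemidirectProduct.range_inl_eq_ker_rightHom, MonoidHom.mem_ker]

/-- The product of the base with the centralizer of `b·aⁿ` is the preimage of `nℤ`. -/
theorem mem_baseH_mul_centralizer_iff {n : ℤ} {g : ZwrZ} :
    g ∈ (baseH : Set ZwrZ) * (Subgroup.centralizer {wb * wa ^ n} : Set ZwrZ) ↔
      n ∣ g.right.toAdd := by
  constructor
  · rintro ⟨h, hh, c, hc, rfl⟩
    have hr : h.right = 1 := mem_baseH_iff.1 hh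
    simpa [hr] using dvd_right_of_mem_centralizer hc
  · rintro ⟨j, hj⟩
    refine ⟨g * ((wb * wa ^ n) ^ j)⁻¹, mem_baseH_iff.2 ?_, (wb * wa ^ n) ^ j, ?_,
      inv_mul_cancel_right _ _⟩
    · rw [map_mul, map_inv, map_zpow, rightHom_wb_mul_wa_zpow, mul_inv_eq_one, ← ofAdd_zsmul,
        smul_eq_mul, mul_comm, ← hj]
      rfl
    · exact Subgroup.mem_centralizer_singleton_iff.2 (Commute.zpow_self _ j)

/-- In `G = ℤ ≀ ℤ`, for all `m, n ∈ ℤ`: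
`m ∣ n` if and only if `H·C_G(b·aᵐ) ⊇ H·C_G(b·aⁿ)`. -/
theorem dvd_iff_base_mul_centralizer_subset (m n : ℤ) :
    m ∣ n ↔
      (baseH : Set ZwrZ) * (Subgroup.centralizer {wb * wa ^ n} : Set ZwrZ) ⊆
        (baseH : Set ZwrZ) * (Subgroup.centralizer {wb * wa ^ m} : Set ZwrZ) := by
  simp only [Set.subset_def, mem_baseH_mul_centralizer_iff]
  refine ⟨fun hmn g hg => hmn.trans hg, fun hsub => ?_⟩
  simpa using hsub (SemidirectProduct.inr (Multiplicative.ofAdd n)) (by simp)
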